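/- (Main Theorem: twisted Poincaré duality.) For every k ∈ ℕ with 0 ≤ k ≤ n there is an isomorphism of ℂ-vector spaces HP_k(R, M) ≅ HP^{n−k}(R) between the k-th Poisson homology of R with values in M and the (n−k)-th Poisson cohomology of R. -/

import Mathlib

open MvPolynomial

noncomputable section

abbrev Rp (n : ℕ) := MvPolynomial (Fin n) ℂ

abbrev cIdx (n : ℕ) (k : ℤ) := {s : Finset (Fin n) // (s.card : ℤ) = k}

/-- `C_k = M ⊗_R Ω^k(R)`: free `R`-module on the increasing wedges `dX_S`. -/
abbrev Ch (n : ℕ) (k : ℤ) := cIdx n k → Rp n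

/-- `m ↦ {m, X u}_M = −{X u, m} + D(X u)·m`, as a ℂ-linear map. -/
def bML {n : ℕ} (a : Fin n → Fin n → ℤ) (u : Fin n) : Rp n →ₗ[ℂ] Rp n :=
  LinearMap.mulLeft ℂ (C (∑ l : Fin n, (a u l : ℂ)) * X u)
    - ∑ j : Fin n, (LinearMap.mulLeft ℂ (C ((a u j : ℂ)) * X u * X j)).comp
        (pderiv j).toLinearMap

/-- Boundary of the Poisson homology complex of `R` with values in `M` (the true
boundary `C_j → C_{j-1}` when `k = j − 1`), written on the basis `m ⊗ dX_S`. -/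
def bnd {n : ℕ} (a : Fin n → Fin n → ℤ) (j k : ℤ) : Ch n j →ₗ[ℂ] Ch n k :=
  LinearMap.pi fun T : cIdx n k =>
    ∑ u : Fin n,
      if u ∈ T.1 then 0
      else if hc : ((insert u T.1).card : ℤ) = j then
        ((-1 : ℂ) ^ ((T.1.filter (fun w => w < u)).card)) •
          ((bML a u + (∑ w ∈ T.1, (a w u : ℂ)) • LinearMap.mulLeft ℂ (X u)).comp
            (LinearMap.proj (⟨insert u T.1, hc⟩ : cIdx n j)))
      else 0

/-- The Poisson cycles `ker ∂_k`. -/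
def Zc {n : ℕ} (a : Fin n → Fin n → ℤ) (k : ℤ) : Submodule ℂ (Ch n k) :=
  LinearMap.ker (bnd a k (k - 1))

/-- The Poisson boundaries `im ∂_{k+1}`, as a submodule of the cycles. -/
def Bc {n : ℕ} (a : Fin n → Fin n → ℤ) (k : ℤ) : Submodule ℂ (Zc a k) :=
  (LinearMap.range (bnd a (k + 1) k)).comap (Zc a k).subtype

/-- The Poisson homology `HP_k(R,M) = ker ∂_k / im ∂_{k+1}`. -/
abbrev HPhom (n : ℕ) (a : Fin n → Fin n → ℤ) (k : ℤ) : Type :=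
  Zc (n := n) a k ⧸ Bc a k


/-- Ambient space of `k`-cochains: arbitrary functions `R^k → R`. -/
abbrev W (n k : ℕ) := (Fin k → Rp n) → Rp n

/-- `m ↦ {g, m}`, the Poisson bracket with `g` on the left, as a ℂ-linear map. -/
def pbL {n : ℕ} (a : Fin n → Fin n → ℤ) (g : Rp n) : Rp n →ₗ[ℂ] Rp n :=
  ∑ j : Fin n, (LinearMap.mulLeft ℂ
      (∑ i : Fin n, C ((a i j : ℂ)) * X i * X j * pderiv i g)).comp
    (pderiv j).toLinearMap

def cmpl {k : ℕ} (i j : Fin (k + 1)) (m : ℕ) : Fin (k + 1) :=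
  (((List.finRange (k + 1)).filter (fun x : Fin (k + 1) => decide (x ≠ i ∧ x ≠ j)))).getD m i

/-- The Poisson coboundary `δ_k`, as a ℂ-linear map on the ambient cochain spaces:
`δP(f_0,…,f_k) = ∑ (−1)^i {f_i, P(…omit f_i…)} + ∑_{i<j} (−1)^{i+j} P({f_i,f_j},…omit f_i,f_j…)`. -/
def dltL {n : ℕ} (a : Fin n → Fin n → ℤ) (k : ℕ) : W n k →ₗ[ℂ] W n (k + 1) :=
  LinearMap.pi fun f : Fin (k + 1) → Rp n =>
    (∑ i : Fin (k + 1), (-1 : ℂ) ^ (i : ℕ) •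
        ((pbL a (f i)).comp (LinearMap.proj (f ∘ i.succAbove))))
    + ∑ i : Fin (k + 1), ∑ j : Fin (k + 1),
        if i < j then
          (-1 : ℂ) ^ ((i : ℕ) + (j : ℕ)) •
            (LinearMap.proj (fun l : Fin k =>
              if (l : ℕ) = 0 then
                ∑ s : Fin n, ∑ t : Fin n,
                  C ((a s t : ℂ)) * X s * X t * pderiv s (f i) * pderiv t (f j)
              else f (cmpl i j ((l : ℕ) - 1))) : W n k →ₗ[ℂ] Rp n)
        else 0

/-- `χ^k(R)`, the `R`-module of skew-symmetric multiderivations, as a ℂ-submodule of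
the ambient space of cochains. -/
def chiSub (n : ℕ) (k : ℕ) : Submodule ℂ (W n k) where
  carrier := {P |
    (∀ (v : Fin k → Rp n) (i : Fin k) (x y : Rp n),
        P (Function.update v i (x + y))
          = P (Function.update v i x) + P (Function.update v i y)) ∧
    (∀ (v : Fin k → Rp n) (i : Fin k) (c : ℂ) (x : Rp n),
        P (Function.update v i (c • x)) = c • P (Function.update v i x)) ∧
    (∀ (v : Fin k → Rp n) (g : Equiv.Perm (Fin k)),
        P (v ∘ g) = ((Equiv.Perm.sign g : ℤ) : ℂ) • P v) ∧
    (∀ (v : Fin k → Rp n) (i : Fin k) (x y : Rp n),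
        P (Function.update v i (x * y))
          = x * P (Function.update v i y) + y * P (Function.update v i x))}
  add_mem' := by
    rintro P Q ⟨hP1, hP2, hP3, hP4⟩ ⟨hQ1, hQ2, hQ3, hQ4⟩
    refine ⟨?_, ?_, ?_, ?_⟩
    · intro v i x y; simp only [Pi.add_apply, hP1, hQ1]; ring
    · intro v i c x; simp only [Pi.add_apply, hP2, hQ2, smul_add]
    · intro v g; simp only [Pi.add_apply, hP3, hQ3, smul_add]
    · intro v i x y; simp only [Pi.add_apply, hP4, hQ4]; ring
  zero_mem' := by
    refine ⟨?_, ?_, ?_, ?_⟩ <;> intros <;> simp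
  smul_mem' := by
    rintro c P ⟨hP1, hP2, hP3, hP4⟩
    refine ⟨?_, ?_, ?_, ?_⟩
    · intro v i x y; simp only [Pi.smul_apply, hP1, smul_add]
    · intro v i c' x; simp only [Pi.smul_apply, hP2]; rw [smul_comm]
    · intro v g; simp only [Pi.smul_apply, hP3]; rw [smul_comm]
    · intro v i x y; simp only [Pi.smul_apply, hP4, smul_add, mul_smul_comm]

/-- The coboundaries `im δ_{k-1} ⊆ χ^k` (zero for `k = 0`). -/
def Bcoh (n : ℕ) (a : Fin n → Fin n → ℤ) : (k : ℕ) → Submodule ℂ (W n k)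
  | 0 => ⊥
  | (k + 1) => Submodule.map (dltL a k) (chiSub n k)

/-- The cocycles `ker δ_k ⊆ χ^k`. -/
def Zcoh (n : ℕ) (a : Fin n → Fin n → ℤ) (k : ℕ) : Submodule ℂ (W n k) :=
  chiSub n k ⊓ LinearMap.ker (dltL a k)

/-- The Poisson cohomology `HP^k(R) = ker δ_k / im δ_{k-1}`. -/
abbrev HPcoh (n : ℕ) (a : Fin n → Fin n → ℤ) (k : ℕ) : Type :=
  Zcoh n a k ⧸ (Bcoh n a k).comap (Zcoh n a k).subtype


/-- The Poisson bracket as a ℂ-bilinear map. -/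
def poissonBracket {n : ℕ} (a : Fin n → Fin n → ℤ) : Rp n →ₗ[ℂ] Rp n →ₗ[ℂ] Rp n :=
  LinearMap.mk₂ ℂ (fun f g => ∑ s : Fin n, ∑ t : Fin n,
      C ((a s t : ℂ)) * X s * X t * pderiv s f * pderiv t g)
    (fun f f' g => by simp only [map_add, mul_add, add_mul, Finset.sum_add_distrib])
    (fun c f g => by
      simp only [Derivation.map_smul, mul_smul_comm, smul_mul_assoc, Finset.smul_sum])
    (fun f g g' => by simp only [map_add, mul_add, Finset.sum_add_distrib])
    (fun c f g => by simp only [Derivation.map_smul, mul_smul_comm, Finset.smul_sum])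

section Bracket

variable {n : ℕ} (a : Fin n → Fin n → ℤ)

theorem poissonBracket_apply (f g : Rp n) : poissonBracket a f g = ∑ s : Fin n, ∑ t : Fin n,
    C ((a s t : ℂ)) * X s * X t * pderiv s f * pderiv t g := rfl

theorem pbL_eq_poissonBracket (f g : Rp n) : pbL a f g = poissonBracket a f g := by
  simp only [pbL, poissonBracket_apply, LinearMap.sum_apply, LinearMap.comp_apply,
    LinearMap.mulLeft_apply, Finset.sum_mul]
  exact Finset.sum_comm

theorem poissonBracket_mul_left (f g h : Rp n) :
    poissonBracket a (f * g) h = f * poissonBracket a g h + g * poissonBracket a f h := by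
  simp only [poissonBracket_apply, Finset.mul_sum, ← Finset.sum_add_distrib, Derivation.leibniz,
    smul_eq_mul]
  exact Finset.sum_congr rfl fun s _ => Finset.sum_congr rfl fun t _ => by ring

theorem poissonBracket_X_left (u : Fin n) (g : Rp n) :
    poissonBracket a (X u) g = ∑ t : Fin n, C ((a u t : ℂ)) * X u * X t * pderiv t g := by
  rw [poissonBracket_apply, Finset.sum_eq_single u]
  · simp
  · intro s _ hs
    simp [pderiv_X_of_ne hs.symm]
  · simp

theorem poissonBracket_X_X (u w : Fin n) :
    poissonBracket a (X u) (X w) = (a u w : ℂ) • (X u * X w) := by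
  rw [poissonBracket_X_left, Finset.sum_eq_single w]
  · simp [smul_eq_C_mul, mul_assoc]
  · intro s _ hs
    simp [pderiv_X_of_ne hs.symm]
  · simp

variable {a}

theorem poissonBracket_swap (ha : ∀ i j, a j i = - a i j) (f g : Rp n) :
    poissonBracket a g f = - poissonBracket a f g := by
  simp only [poissonBracket_apply]
  rw [Finset.sum_comm, ← Finset.sum_neg_distrib]
  refine Finset.sum_congr rfl fun s _ => ?_
  rw [← Finset.sum_neg_distrib]
  refine Finset.sum_congr rfl fun t _ => ?_
  rw [ha s t]
  simp only [Int.cast_neg, map_neg]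
  ring

end Bracket

section Cochains

variable {n k : ℕ}

/-- A skew-symmetric multiderivation as an alternating map. -/
def chiSub.toAlternatingMap {P : W n k} (hP : P ∈ chiSub n k) : Rp n [⋀^Fin k]→ₗ[ℂ] Rp n where
  toFun := P
  map_update_add' := by
    intro inst v i x y
    convert hP.1 v i x y
  map_update_smul' := by
    intro inst v i c x
    convert hP.2.1 v i c x
  map_eq_zero_of_eq' := by
    intro v i j hv hij
    have h := hP.2.2.1 v (Equiv.swap i j)
    have hv' : v ∘ Equiv.swap i j = v := by
      funext l
      rcases eq_or_ne l i with rfl | hi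
      · simp [hv]
      rcases eq_or_ne l j with rfl | hj
      · simp [hv]
      simp [Equiv.swap_apply_of_ne_of_ne hi hj]
    rw [hv', Equiv.Perm.sign_swap hij] at h
    simpa [eq_neg_iff_add_eq_zero, ← two_smul ℂ] using h

@[simp]
theorem chiSub.coe_toAlternatingMap {P : W n k} (hP : P ∈ chiSub n k) :
    ⇑(chiSub.toAlternatingMap hP) = P := rfl

theorem AlternatingMap.mem_chiSub_of_leibniz (ω : Rp n [⋀^Fin k]→ₗ[ℂ] Rp n)
    (h : ∀ (v : Fin k → Rp n) (i : Fin k) (x y : Rp n), ω (Function.update v i (x * y))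
      = x * ω (Function.update v i y) + y * ω (Function.update v i x)) :
    (⇑ω : W n k) ∈ chiSub n k := by
  refine ⟨fun v i x y => ω.map_update_add v i x y, fun v i c x => ω.map_update_smul v i c x,
    fun v g => ?_, h⟩
  rw [ω.map_perm]
  simp [Units.smul_def, ← Int.cast_smul_eq_zsmul ℂ]

/-- For an alternating map the Leibniz rule need only be checked in the first argument. -/
theorem AlternatingMap.mem_chiSub_of_leibniz_vecCons (ω : Rp n [⋀^Fin (k + 1)]→ₗ[ℂ] Rp n)
    (h : ∀ (v : Fin k → Rp n) (x y : Rp n), ω (Matrix.vecCons (x * y) v)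
      = x * ω (Matrix.vecCons y v) + y * ω (Matrix.vecCons x v)) :
    (⇑ω : W n (k + 1)) ∈ chiSub n (k + 1) := by
  refine ω.mem_chiSub_of_leibniz fun v i x y => ?_
  have key (z : Rp n) : ω (Function.update v i z)
      = (-1) ^ (i : ℕ) • ω (Matrix.vecCons z (i.removeNth v)) := by
    rw [← ω.map_insertNth, Fin.insertNth_removeNth]
  simp only [key, h, smul_add, mul_smul_comm]

theorem chiSub.vecCons_mul {P : W n (k + 1)} (hP : P ∈ chiSub n (k + 1)) (v : Fin k → Rp n)
    (x y : Rp n) : P (Matrix.vecCons (x * y) v)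
      = x * P (Matrix.vecCons y v) + y * P (Matrix.vecCons x v) := by
  have h := hP.2.2.2 (Matrix.vecCons x v) 0 x y
  simpa [Matrix.vecCons] using h

end Cochains

section DoubleSums

variable {k : ℕ} {N : Type*} [AddCommGroup N] [Module ℂ N]

theorem filter_finRange_succAbove (i : Fin (k + 2)) (j : Fin (k + 1)) :
    (List.finRange (k + 2)).filter (fun x => decide (x ≠ i ∧ x ≠ i.succAbove j))
      = (List.finRange k).map (fun m => i.succAbove (j.succAbove m)) := by
  have hmono : StrictMono (fun m => i.succAbove (j.succAbove m)) :=
    i.strictMono_succAbove.comp j.strictMono_succAbove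
  refine List.Perm.eq_of_pairwise (le := (· < ·)) (fun a b _ _ h₁ h₂ => (h₁.asymm h₂).elim)
    ((List.pairwise_lt_finRange _).filter _)
    (List.pairwise_map.2 ((List.pairwise_lt_finRange _).imp fun h => hmono h)) ?_
  refine (List.perm_ext_iff_of_nodup ((List.nodup_finRange _).filter _)
    ((List.nodup_finRange _).map hmono.injective)).2 fun x => ?_
  simp only [List.mem_filter, List.mem_finRange, true_and, decide_eq_true_eq, List.mem_map]
  constructor
  · rintro ⟨hi, hj⟩
    obtain ⟨y, rfl⟩ := Fin.exists_succAbove_eq hi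
    obtain ⟨z, rfl⟩ := Fin.exists_succAbove_eq (fun h : y = j => hj (h ▸ rfl))
    exact ⟨z, rfl⟩
  · rintro ⟨z, rfl⟩
    exact ⟨Fin.succAbove_ne _ _, fun h =>
      Fin.succAbove_ne j z (Fin.succAbove_right_injective h)⟩

theorem cmpl_succAbove (i : Fin (k + 2)) (j : Fin (k + 1)) (m : Fin k) :
    cmpl i (i.succAbove j) m = i.succAbove (j.succAbove m) := by
  rw [cmpl, filter_finRange_succAbove]
  simp [List.getD]

theorem cmpl_comm {i j : Fin (k + 2)} (hij : i ≠ j) (m : Fin k) : cmpl i j m = cmpl j i m := by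
  have h : (List.finRange (k + 2)).filter (fun x => decide (x ≠ j ∧ x ≠ i))
      = (List.finRange (k + 2)).filter (fun x => decide (x ≠ i ∧ x ≠ j)) := by
    simp only [and_comm]
  obtain ⟨j, rfl⟩ := Fin.exists_succAbove_eq hij.symm
  rw [cmpl, cmpl, h, filter_finRange_succAbove]
  simp [List.getD]

/-- The sign with which the pair `(i, j)` of removed indices enters an iterated alternating sum. -/
def pairSign (i j : Fin k) : ℂ :=
  if j < i then (-1) ^ (i + j : ℕ) else if i < j then - (-1) ^ (i + j : ℕ) else 0

theorem pairSign_swap (i j : Fin k) : pairSign j i = - pairSign i j := by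
  rcases lt_trichotomy i j with h | rfl | h <;> simp [pairSign, add_comm, *, not_lt_of_gt]

theorem sum_sum_succAbove (G : Fin (k + 2) → Fin (k + 2) → N) :
    ∑ i : Fin (k + 2), (-1 : ℤ) ^ (i : ℕ) • ∑ j : Fin (k + 1), (-1 : ℤ) ^ (j : ℕ) •
      G i (i.succAbove j) = ∑ i, ∑ j, pairSign i j • G i j := by
  refine Finset.sum_congr rfl fun i _ => ?_
  rw [Fin.sum_univ_succAbove _ i, Finset.smul_sum]
  simp only [pairSign, lt_irrefl, if_false, zero_smul, zero_add]
  refine Finset.sum_congr rfl fun j _ => ?_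
  rw [smul_smul, ← pow_add, ← Int.cast_smul_eq_zsmul ℂ]
  congr 1
  rcases lt_or_ge j.castSucc i with h | h
  · rw [Fin.succAbove_of_castSucc_lt _ _ h]
    simp [h]
  · rw [Fin.succAbove_of_le_castSucc _ _ h]
    have h' : i < j.succ := lt_of_le_of_lt h Fin.castSucc_lt_succ
    simp [h', not_lt_of_gt h', ← add_assoc, pow_succ]

theorem sum_pairSign_antisymm {G : Fin k → Fin k → N} (hG : ∀ i j, i ≠ j → G j i = - G i j) :
    ∑ i, ∑ j, pairSign i j • G i j
      = - (2 : ℂ) • ∑ i : Fin k, ∑ j : Fin k,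
        if i < j then (-1 : ℂ) ^ (i + j : ℕ) • G i j else 0 := by
  have h : ∀ i j, pairSign i j • G i j =
      - (if i < j then (-1 : ℂ) ^ (i + j : ℕ) • G i j else 0)
      - (if j < i then (-1 : ℂ) ^ (j + i : ℕ) • G j i else 0) := by
    intro i j
    rcases lt_trichotomy i j with h | rfl | h
    · simp [pairSign, h, not_lt_of_gt h]
    · simp [pairSign]
    · simp [pairSign, h, not_lt_of_gt h, hG j i h.ne, add_comm]
  simp only [h, Finset.sum_sub_distrib, Finset.sum_neg_distrib]
  rw [Finset.sum_comm (f := fun i j : Fin k => if j < i then (-1 : ℂ) ^ ((j : ℕ) + i) • G j i else 0)]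
  rw [neg_smul, two_smul]
  abel

theorem sum_pairSign_sub_swap (H : Fin k → Fin k → N) :
    ∑ i, ∑ j, pairSign i j • (H i j - H j i) = (2 : ℂ) • ∑ i, ∑ j, pairSign i j • H i j := by
  simp only [smul_sub, Finset.sum_sub_distrib]
  rw [Finset.sum_comm (f := fun i j => pairSign i j • H j i)]
  have h : ∑ j, ∑ i, pairSign i j • H j i = - ∑ i, ∑ j, pairSign i j • H i j := by
    simp only [← Finset.sum_neg_distrib, ← neg_smul, ← pairSign_swap]
  rw [h, sub_neg_eq_add, two_smul]

end DoubleSums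

section Coboundary

variable {n k : ℕ} {a : Fin n → Fin n → ℤ}

theorem dltL_zero_apply (P : W n 0) (f : Fin 1 → Rp n) :
    dltL a 0 P f = poissonBracket a (f 0) (P ![]) := by
  have h : ∀ g : Fin 0 → Rp n, g = ![] := fun g => Subsingleton.elim _ _
  simp [dltL, pbL_eq_poissonBracket, h]

theorem dltL_succ_apply (P : W n (k + 1)) (f : Fin (k + 2) → Rp n) :
    dltL a (k + 1) P f
      = ∑ i : Fin (k + 2), (-1 : ℤ) ^ (i : ℕ) • poissonBracket a (f i) (P (i.removeNth f))
      + ∑ i : Fin (k + 2), ∑ j : Fin (k + 2), if i < j then (-1 : ℂ) ^ (i + j : ℕ) •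
          P (Matrix.vecCons (poissonBracket a (f i) (f j)) fun m : Fin k => f (cmpl i j m))
        else 0 := by
  have h (i j : Fin (k + 2)) : (fun l : Fin (k + 1) => if (l : ℕ) = 0 then
      ∑ s : Fin n, ∑ t : Fin n, C ((a s t : ℂ)) * X s * X t * pderiv s (f i) * pderiv t (f j)
      else f (cmpl i j ((l : ℕ) - 1)))
      = Matrix.vecCons (poissonBracket a (f i) (f j)) fun m : Fin k => f (cmpl i j m) := by
    funext l
    cases l using Fin.cases <;> simp [poissonBracket_apply]
  simp only [dltL, LinearMap.pi_apply, LinearMap.add_apply, LinearMap.sum_apply, h,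
    LinearMap.smul_apply, LinearMap.comp_apply, LinearMap.proj_apply, pbL_eq_poissonBracket]
  congr 1
  · refine Finset.sum_congr rfl fun i _ => ?_
    rw [← Int.cast_smul_eq_zsmul ℂ]
    push_cast
    rfl
  · refine Finset.sum_congr rfl fun i _ => Finset.sum_congr rfl fun j _ => ?_
    split_ifs <;> rfl

/-- The iterated alternating sum computing (twice, up to sign) the bracket part of the
Poisson coboundary. -/
def bracketSum (a : Fin n → Fin n → ℤ) (P : W n (k + 1)) (f : Fin (k + 2) → Rp n) : Rp n :=
  ∑ i : Fin (k + 2), (-1 : ℤ) ^ (i : ℕ) • ∑ j : Fin (k + 1), (-1 : ℤ) ^ (j : ℕ) •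
    P (Matrix.vecCons (poissonBracket a (f i) (i.removeNth f j)) (j.removeNth (i.removeNth f)))

theorem bracketSum_eq_sum_pairSign (P : W n (k + 1)) (f : Fin (k + 2) → Rp n) :
    bracketSum a P f = ∑ i, ∑ j, pairSign i j •
      P (Matrix.vecCons (poissonBracket a (f i) (f j)) fun m : Fin k => f (cmpl i j m)) := by
  rw [← sum_sum_succAbove]
  simp only [cmpl_succAbove]
  rfl

theorem dltL_succ_apply_eq_bracketSum (ha : ∀ i j, a j i = - a i j) {P : W n (k + 1)}
    (hP : P ∈ chiSub n (k + 1)) (f : Fin (k + 2) → Rp n) :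
    dltL a (k + 1) P f
      = ∑ i : Fin (k + 2), (-1 : ℤ) ^ (i : ℕ) • poissonBracket a (f i) (P (i.removeNth f))
      - (1 / 2 : ℂ) • bracketSum a P f := by
  rw [dltL_succ_apply, bracketSum_eq_sum_pairSign, sum_pairSign_antisymm, smul_smul, sub_eq_add_neg,
    ← neg_smul]
  · norm_num
  · intro i j hij
    simp only [poissonBracket_swap ha (f i) (f j), cmpl_comm hij.symm]
    have h := (chiSub.toAlternatingMap hP).map_vecCons_smul
      (fun m : Fin k => f (cmpl i j m)) (-1 : ℂ) (poissonBracket a (f i) (f j))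
    simpa using h

/-- The Poisson coboundary of an alternating map of positive degree, as an alternating map. -/
def alternatingCoboundary (a : Fin n → Fin n → ℤ) (ω : Rp n [⋀^Fin (k + 1)]→ₗ[ℂ] Rp n) :
    Rp n [⋀^Fin (k + 2)]→ₗ[ℂ] Rp n :=
  AlternatingMap.alternatizeUncurryFin
    { toFun := fun g => (poissonBracket a g).compAlternatingMap ω
      map_add' := fun g h => by ext; simp
      map_smul' := fun c g => by ext; simp }
  - (1 / 2 : ℂ) • AlternatingMap.alternatizeUncurryFin
    (AlternatingMap.alternatizeUncurryFinLM ∘ₗ (poissonBracket a).compr₂ ω.curryLeft)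

theorem coe_alternatingCoboundary (ha : ∀ i j, a j i = - a i j) {P : W n (k + 1)}
    (hP : P ∈ chiSub n (k + 1)) :
    ⇑(alternatingCoboundary a (chiSub.toAlternatingMap hP)) = dltL a (k + 1) P := by
  funext f
  rw [dltL_succ_apply_eq_bracketSum ha hP]
  simp [alternatingCoboundary, AlternatingMap.alternatizeUncurryFin_apply, bracketSum]

theorem removeNth_succ_vecCons (i : Fin (k + 1)) (x : Rp n) (v : Fin (k + 1) → Rp n) :
    i.succ.removeNth (Matrix.vecCons x v) = Matrix.vecCons x (i.removeNth v) := by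
  funext l
  cases l using Fin.cases <;> simp [Fin.removeNth]

theorem bracketSum_vecCons (ha : ∀ i j, a j i = - a i j) {P : W n (k + 1)}
    (hP : P ∈ chiSub n (k + 1)) (x : Rp n) (v : Fin (k + 1) → Rp n) :
    bracketSum a P (Matrix.vecCons x v)
      = (2 : ℂ) • ∑ j : Fin (k + 1), (-1 : ℤ) ^ (j : ℕ) •
          P (Matrix.vecCons (poissonBracket a x (v j)) (j.removeNth v))
        + ∑ i : Fin (k + 1), ∑ j : Fin k, (-1 : ℤ) ^ (i + j : ℕ) •
          P (Matrix.vecCons (poissonBracket a (v i) (i.removeNth v j))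
            (j.succ.removeNth (Matrix.vecCons x (i.removeNth v)))) := by
  have h (y : Rp n) (w : Fin k → Rp n) : P (Matrix.vecCons (poissonBracket a y x) w)
      = - P (Matrix.vecCons (poissonBracket a x y) w) := by
    rw [poissonBracket_swap ha x y]
    simpa using (chiSub.toAlternatingMap hP).map_vecCons_smul w (-1 : ℂ) (poissonBracket a x y)
  have h₀ : (0 : Fin (k + 2)).removeNth (Matrix.vecCons x v) = v := rfl
  have hsucc (i : Fin (k + 1)) : (-1 : ℤ) ^ ((i.succ : Fin (k + 2)) : ℕ) •
      ∑ j : Fin (k + 1), (-1 : ℤ) ^ (j : ℕ) •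
        P (Matrix.vecCons (poissonBracket a (v i)
          ((Matrix.vecCons x (i.removeNth v) : Fin (k + 1) → Rp n) j))
          (j.removeNth (Matrix.vecCons x (i.removeNth v))))
      = (-1 : ℤ) ^ (i : ℕ) • P (Matrix.vecCons (poissonBracket a x (v i)) (i.removeNth v))
        + ∑ j : Fin k, (-1 : ℤ) ^ (i + j : ℕ) •
          P (Matrix.vecCons (poissonBracket a (v i) (i.removeNth v j))
            (j.succ.removeNth (Matrix.vecCons x (i.removeNth v)))) := by
    have h₁ : (0 : Fin (k + 1)).removeNth (Matrix.vecCons x (i.removeNth v)) = i.removeNth v := rfl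
    rw [Fin.sum_univ_succ, h₁, Matrix.cons_val_zero, h, smul_add, Finset.smul_sum]
    congr 1
    · simp [pow_succ]
    · refine Finset.sum_congr rfl fun j _ => ?_
      rw [smul_smul, Matrix.cons_val_succ, Fin.val_succ, Fin.val_succ]
      congr 1
      ring
  rw [bracketSum, Fin.sum_univ_succ, h₀]
  simp only [removeNth_succ_vecCons, Matrix.cons_val_succ, hsucc, Finset.sum_add_distrib,
    Matrix.cons_val_zero, Fin.val_zero, pow_zero, one_smul, two_smul]
  abel

theorem sum_bracket_mul_vecCons {P : W n (k + 1)} (hP : P ∈ chiSub n (k + 1))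
    (v : Fin (k + 1) → Rp n) (x y : Rp n) :
    ∑ j : Fin (k + 1), (-1 : ℤ) ^ (j : ℕ) •
        P (Matrix.vecCons (poissonBracket a (x * y) (v j)) (j.removeNth v))
      = x * ∑ j : Fin (k + 1), (-1 : ℤ) ^ (j : ℕ) •
          P (Matrix.vecCons (poissonBracket a y (v j)) (j.removeNth v))
      + y * ∑ j : Fin (k + 1), (-1 : ℤ) ^ (j : ℕ) •
          P (Matrix.vecCons (poissonBracket a x (v j)) (j.removeNth v))
      + ∑ j : Fin (k + 1), (-1 : ℤ) ^ (j : ℕ) •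
        (poissonBracket a y (v j) * P (Matrix.vecCons x (j.removeNth v))
          + poissonBracket a x (v j) * P (Matrix.vecCons y (j.removeNth v))) := by
  simp only [Finset.mul_sum, ← Finset.sum_add_distrib, mul_smul_comm, ← smul_add]
  refine Finset.sum_congr rfl fun j _ => ?_
  have hadd : ∀ z w : Rp n, P (Matrix.vecCons (z + w) (j.removeNth v))
      = P (Matrix.vecCons z (j.removeNth v)) + P (Matrix.vecCons w (j.removeNth v)) :=
    fun z w => (chiSub.toAlternatingMap hP).map_vecCons_add _ z w
  rw [poissonBracket_mul_left, hadd, chiSub.vecCons_mul hP, chiSub.vecCons_mul hP]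
  congr 1
  ring

theorem sum_sum_bracket_vecCons_mul {P : W n (k + 1)} (hP : P ∈ chiSub n (k + 1))
    (v : Fin (k + 1) → Rp n) (x y : Rp n) :
    ∑ i : Fin (k + 1), ∑ j : Fin k, (-1 : ℤ) ^ (i + j : ℕ) •
        P (Matrix.vecCons (poissonBracket a (v i) (i.removeNth v j))
          (j.succ.removeNth (Matrix.vecCons (x * y) (i.removeNth v))))
      = x * ∑ i : Fin (k + 1), ∑ j : Fin k, (-1 : ℤ) ^ (i + j : ℕ) •
        P (Matrix.vecCons (poissonBracket a (v i) (i.removeNth v j))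
          (j.succ.removeNth (Matrix.vecCons y (i.removeNth v))))
      + y * ∑ i : Fin (k + 1), ∑ j : Fin k, (-1 : ℤ) ^ (i + j : ℕ) •
        P (Matrix.vecCons (poissonBracket a (v i) (i.removeNth v j))
          (j.succ.removeNth (Matrix.vecCons x (i.removeNth v)))) := by
  simp only [Finset.mul_sum, ← Finset.sum_add_distrib, mul_smul_comm, ← smul_add]
  refine Finset.sum_congr rfl fun i _ => Finset.sum_congr rfl fun j _ => ?_
  congr 1
  cases k with
  | zero => exact j.elim0
  | succ k =>
    have hslot (c z : Rp n) (w : Fin k → Rp n) :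
        Function.update (Matrix.vecCons c (Matrix.vecCons 0 w)) 1 z
          = Matrix.vecCons c (Matrix.vecCons z w) := by
      funext l
      cases l using Fin.cases with
      | zero => simp
      | succ l => cases l using Fin.cases <;> simp [Function.update, Fin.ext_iff]
    have h := hP.2.2.2 (Matrix.vecCons (poissonBracket a (v i) (i.removeNth v j))
      (Matrix.vecCons 0 (j.removeNth (i.removeNth v)))) 1 x y
    simp only [hslot] at h
    simpa only [removeNth_succ_vecCons] using h

theorem sum_bracket_vecCons_mul {P : W n (k + 1)} (hP : P ∈ chiSub n (k + 1))
    (v : Fin (k + 1) → Rp n) (x y : Rp n) :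
    ∑ i : Fin (k + 1), (-1 : ℤ) ^ (i : ℕ) •
        poissonBracket a (P (Matrix.vecCons (x * y) (i.removeNth v))) (v i)
      = x * ∑ i : Fin (k + 1), (-1 : ℤ) ^ (i : ℕ) •
        poissonBracket a (P (Matrix.vecCons y (i.removeNth v))) (v i)
      + y * ∑ i : Fin (k + 1), (-1 : ℤ) ^ (i : ℕ) •
        poissonBracket a (P (Matrix.vecCons x (i.removeNth v))) (v i)
      + ∑ j : Fin (k + 1), (-1 : ℤ) ^ (j : ℕ) •
        (poissonBracket a y (v j) * P (Matrix.vecCons x (j.removeNth v))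
          + poissonBracket a x (v j) * P (Matrix.vecCons y (j.removeNth v))) := by
  simp only [Finset.mul_sum, ← Finset.sum_add_distrib]
  refine Finset.sum_congr rfl fun j _ => ?_
  rw [chiSub.vecCons_mul hP]
  generalize P (Matrix.vecCons x (j.removeNth v)) = p
  generalize P (Matrix.vecCons y (j.removeNth v)) = q
  rw [map_add, LinearMap.add_apply, poissonBracket_mul_left, poissonBracket_mul_left]
  simp only [zsmul_eq_mul]
  ring

theorem dltL_succ_vecCons (ha : ∀ i j, a j i = - a i j) {P : W n (k + 1)}
    (hP : P ∈ chiSub n (k + 1)) (z : Rp n) (v : Fin (k + 1) → Rp n) :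
    dltL a (k + 1) P (Matrix.vecCons z v) = poissonBracket a z (P v)
      + ∑ i : Fin (k + 1), (-1 : ℤ) ^ (i : ℕ) •
        poissonBracket a (P (Matrix.vecCons z (i.removeNth v))) (v i)
      - ∑ j : Fin (k + 1), (-1 : ℤ) ^ (j : ℕ) •
        P (Matrix.vecCons (poissonBracket a z (v j)) (j.removeNth v))
      - (1 / 2 : ℂ) • ∑ i : Fin (k + 1), ∑ j : Fin k, (-1 : ℤ) ^ (i + j : ℕ) •
        P (Matrix.vecCons (poissonBracket a (v i) (i.removeNth v j))
          (j.succ.removeNth (Matrix.vecCons z (i.removeNth v)))) := by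
  have h₀ : (0 : Fin (k + 2)).removeNth (Matrix.vecCons z v) = v := rfl
  have h₂ (w : Rp n) : (1 / 2 : ℂ) • (2 : ℂ) • w = w := by
    rw [smul_smul]
    norm_num
  rw [dltL_succ_apply_eq_bracketSum ha hP, bracketSum_vecCons ha hP, smul_add, h₂,
    Fin.sum_univ_succ, h₀, sub_add_eq_sub_sub]
  simp only [removeNth_succ_vecCons, Matrix.cons_val_succ, Matrix.cons_val_zero, Fin.val_zero,
    pow_zero, one_smul, Fin.val_succ, pow_succ, mul_neg, mul_one, neg_smul,
    poissonBracket_swap ha (P _) (v _), smul_neg, neg_neg]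

theorem dltL_mem_chiSub (ha : ∀ i j, a j i = - a i j) {P : W n k} (hP : P ∈ chiSub n k) :
    dltL a k P ∈ chiSub n (k + 1) := by
  cases k with
  | zero =>
    have h : dltL a 0 P = ⇑(AlternatingMap.ofSubsingleton ℂ (Rp n) (Rp n) (0 : Fin 1)
        ((poissonBracket a).flip (P ![]))) := by
      funext f
      simp [dltL_zero_apply]
    rw [h]
    refine AlternatingMap.mem_chiSub_of_leibniz_vecCons _ fun v x y => ?_
    simp [poissonBracket_mul_left]
  | succ k =>
    rw [← coe_alternatingCoboundary ha hP]
    refine AlternatingMap.mem_chiSub_of_leibniz_vecCons _ fun v x y => ?_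
    rw [coe_alternatingCoboundary ha hP]
    rw [dltL_succ_vecCons ha hP, dltL_succ_vecCons ha hP, dltL_succ_vecCons ha hP,
      sum_bracket_vecCons_mul hP, sum_bracket_mul_vecCons hP, sum_sum_bracket_vecCons_mul hP,
      poissonBracket_mul_left, smul_add, ← mul_smul_comm, ← mul_smul_comm]
    ring

/-- The Poisson coboundary evaluated on a tuple of coordinate functions. -/
theorem dltL_apply_X (ha : ∀ i j, a j i = - a i j) {P : W n k} (hP : P ∈ chiSub n k)
    (s : Fin (k + 1) → Fin n) :
    dltL a k P (fun i => X (s i)) = ∑ i : Fin (k + 1), (-1 : ℂ) ^ (i : ℕ) •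
      (poissonBracket a (X (s i)) (P fun m => X (s (i.succAbove m)))
        - (∑ j : Fin k, (a (s i) (s (i.succAbove j)) : ℂ)) •
          (X (s i) * P fun m => X (s (i.succAbove m)))) := by
  cases k with
  | zero =>
    have h : ∀ g : Fin 0 → Rp n, g = ![] := fun g => Subsingleton.elim _ _
    simp [dltL_zero_apply, h (fun m => X (s m.succ))]
  | succ k =>
    have hsmul (c : ℂ) (z : Rp n) (w : Fin k → Rp n) :
        P (Matrix.vecCons (c • z) w) = c • P (Matrix.vecCons z w) :=
      (chiSub.toAlternatingMap hP).map_vecCons_smul w c z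
    have hfront (i : Fin (k + 2)) (j : Fin (k + 1)) :
        P (Matrix.vecCons (X (s (i.succAbove j))) fun m => X (s (i.succAbove (j.succAbove m))))
          = (-1 : ℤ) ^ (j : ℕ) • P fun m => X (s (i.succAbove m)) := by
      have h := (chiSub.toAlternatingMap hP).neg_one_pow_smul_map_insertNth j
        (X (s (i.succAbove j))) fun m => X (s (i.succAbove (j.succAbove m)))
      have h' : (j.insertNth (X (s (i.succAbove j))) fun m => X (s (i.succAbove (j.succAbove m))) :
          Fin (k + 1) → Rp n) = fun m => X (s (i.succAbove m)) :=
        Fin.insertNth_self_removeNth j fun m => (X (s (i.succAbove m)) : Rp n)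
      rw [h'] at h
      exact h.symm
    have hB : bracketSum a P (fun i => X (s i)) = (2 : ℂ) • ∑ i : Fin (k + 2), (-1 : ℤ) ^ (i : ℕ) •
        (∑ j : Fin (k + 1), (a (s i) (s (i.succAbove j)) : ℂ)) •
          (X (s i) * P fun m => X (s (i.succAbove m))) := by
      let H (i j : Fin (k + 2)) : Rp n := (a (s i) (s j) : ℂ) •
        (X (s i) * P (Matrix.vecCons (X (s j)) fun m : Fin k => X (s (cmpl i j m))))
      have hH (i j : Fin (k + 2)) : pairSign i j • P (Matrix.vecCons
          (poissonBracket a (X (s i)) (X (s j))) fun m : Fin k => X (s (cmpl i j m)))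
          = pairSign i j • (H i j - H j i) := by
        rcases eq_or_ne i j with rfl | hij
        · simp [pairSign]
        · simp only [H, poissonBracket_X_X, hsmul, chiSub.vecCons_mul hP, ha (s i) (s j),
            cmpl_comm hij.symm, smul_add, Int.cast_neg, neg_smul, sub_neg_eq_add]
      rw [bracketSum_eq_sum_pairSign]
      simp only [hH]
      rw [sum_pairSign_sub_swap, ← sum_sum_succAbove]
      congr 1
      refine Finset.sum_congr rfl fun i _ => ?_
      rw [Finset.sum_smul]
      congr 1
      refine Finset.sum_congr rfl fun j _ => ?_
      simp only [H, cmpl_succAbove, hfront, mul_smul_comm]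
      rw [smul_comm, smul_smul, ← pow_add, Even.neg_one_pow ⟨_, rfl⟩, one_smul]
    rw [dltL_succ_apply_eq_bracketSum ha hP, hB, smul_smul, one_div,
      inv_mul_cancel₀ (two_ne_zero' ℂ), one_smul, ← Finset.sum_sub_distrib]
    refine Finset.sum_congr rfl fun i _ => ?_
    rw [← smul_sub, ← Int.cast_smul_eq_zsmul ℂ]
    push_cast
    rfl

end Coboundary

section Duality

variable {n : ℕ} {a : Fin n → Fin n → ℤ}

/-- Evaluation of a `q`-cochain on the coordinate functions indexed by `S`, in increasing order
(and zero if `S` does not have `q` elements). -/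
def evalOn (q : ℕ) (S : Finset (Fin n)) : W n q →ₗ[ℂ] Rp n :=
  if h : S.card = q then LinearMap.proj (fun i => X (S.orderEmbOfFin h i)) else 0

theorem evalOn_apply {q : ℕ} {S : Finset (Fin n)} (h : S.card = q) (P : W n q) :
    evalOn q S P = P fun i => X (S.orderEmbOfFin h i) := by
  rw [evalOn, dif_pos h]
  rfl

theorem evalOn_dltL (ha : ∀ i j, a j i = - a i j) {q : ℕ} {P : W n q} (hP : P ∈ chiSub n q)
    {S : Finset (Fin n)} (hS : S.card = q + 1) :
    evalOn (q + 1) S (dltL a q P) = ∑ u ∈ S, (-1 : ℂ) ^ (S.filter (fun w => w < u)).card •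
      (poissonBracket a (X u) (evalOn q (S.erase u) P)
        - (∑ w ∈ S.erase u, (a u w : ℂ)) • (X u * evalOn q (S.erase u) P)) := by
  obtain ⟨e, he⟩ : ∃ e, e = S.orderEmbOfFin hS := ⟨_, rfl⟩
  have hmap : S = Finset.univ.map e.toEmbedding := by
    rw [he, Finset.map_orderEmbOfFin_univ]
  have hfilter (i : Fin (q + 1)) : (S.filter (fun w => w < e i)).card = i := by
    have h : S.filter (fun w => w < e i) = (Finset.Iio i).map e.toEmbedding := by
      rw [hmap]
      ext w
      simp only [Finset.mem_filter, Finset.mem_map, Finset.mem_univ, true_and, Finset.mem_Iio]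
      constructor
      · rintro ⟨⟨l, rfl⟩, hl⟩
        exact ⟨l, e.lt_iff_lt.1 hl, rfl⟩
      · rintro ⟨l, hl, rfl⟩
        exact ⟨⟨l, rfl⟩, e.lt_iff_lt.2 hl⟩
    rw [h, Finset.card_map, Fin.card_Iio]
  have herase (i : Fin (q + 1)) :
      S.erase (e i) = Finset.univ.map (i.succAboveEmb.trans e.toEmbedding) := by
    rw [hmap]
    ext w
    simp only [Finset.mem_erase, Finset.mem_map, Finset.mem_univ, true_and]
    constructor
    · rintro ⟨hne, l, rfl⟩
      obtain ⟨m, rfl⟩ := Fin.exists_succAbove_eq (fun h : l = i => hne (h ▸ rfl))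
      exact ⟨m, rfl⟩
    · rintro ⟨m, rfl⟩
      exact ⟨fun h => Fin.succAbove_ne i m (e.injective h), _, rfl⟩
  have heval (i : Fin (q + 1)) : evalOn q (S.erase (e i)) P
      = P fun m => X (e (i.succAbove m)) := by
    have hcard : (S.erase (e i)).card = q := by rw [herase]; simp
    have h : (fun m => e (i.succAbove m)) = (S.erase (e i)).orderEmbOfFin hcard := by
      refine Finset.orderEmbOfFin_unique hcard (fun m => ?_)
        (e.strictMono.comp i.strictMono_succAbove)
      rw [herase]
      exact Finset.mem_map.2 ⟨m, Finset.mem_univ _, rfl⟩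
    rw [evalOn_apply hcard]
    exact congrArg P (funext fun m => congrArg X (congrFun h.symm m))
  have hsum (g : Fin n → Rp n) : ∑ u ∈ S, g u = ∑ i, g (e i) := by
    conv_lhs => rw [hmap]
    rw [Finset.sum_map]
    rfl
  have hsum' (i : Fin (q + 1)) (g : Fin n → ℂ) :
      ∑ w ∈ S.erase (e i), g w = ∑ m, g (e (i.succAbove m)) := by
    rw [herase, Finset.sum_map]
    rfl
  rw [evalOn_apply hS, ← he, dltL_apply_X ha hP, hsum]
  simp only [hfilter, heval, hsum']

/-- The sign relating the chain `dX_T` to the cochain dual to the complement of `T`. -/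
def dualSign (T : Finset (Fin n)) : ℂ := (-1) ^ (∑ w ∈ T, (w : ℕ))

theorem dualSign_mul_self (T : Finset (Fin n)) : dualSign T * dualSign T = 1 := by
  rw [dualSign, ← pow_add, Even.neg_one_pow ⟨_, rfl⟩]

theorem neg_one_pow_mul_dualSign_insert {T : Finset (Fin n)} {u : Fin n} (hu : u ∉ T) :
    (-1 : ℂ) ^ (T.filter (fun w => w < u)).card * dualSign (insert u T)
      = dualSign T * (-1 : ℂ) ^ (Tᶜ.filter (fun w => w < u)).card := by
  have h : (T.filter (fun w => w < u)).card + (Tᶜ.filter (fun w => w < u)).card = u := by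
    rw [← Finset.card_union_of_disjoint
      (Finset.disjoint_filter_filter (disjoint_compl_right)), ← Finset.filter_union,
      Finset.union_compl, Finset.filter_gt_eq_Iio, Fin.card_Iio]
  have hu' : (-1 : ℂ) ^ (u : ℕ) = (-1 : ℂ) ^ (T.filter (fun w => w < u)).card *
      (-1 : ℂ) ^ (Tᶜ.filter (fun w => w < u)).card := by
    rw [← pow_add, h]
  rw [dualSign, Finset.sum_insert hu, pow_add, hu', dualSign]
  have hsq : (-1 : ℂ) ^ (T.filter (fun w => w < u)).card *
      (-1 : ℂ) ^ (T.filter (fun w => w < u)).card = 1 := by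
    rw [← pow_add, Even.neg_one_pow ⟨_, rfl⟩]
  linear_combination (-1 : ℂ) ^ (Tᶜ.filter (fun w => w < u)).card *
    (-1 : ℂ) ^ (∑ w ∈ T, (w : ℕ)) * hsq

/-- The comparison map from `q`-cochains to `j`-chains (meaningful for `j + q = n`), given by
contraction with the volume form `dX_1 ∧ ⋯ ∧ dX_n`. -/
def dualityMap (n q : ℕ) (j : ℤ) : W n q →ₗ[ℂ] Ch n j :=
  LinearMap.pi fun T : cIdx n j => dualSign T.1 • evalOn q T.1ᶜ

theorem dualityMap_apply {q : ℕ} {j : ℤ} (P : W n q) (T : cIdx n j) :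
    dualityMap n q j P T = dualSign T.1 • evalOn q T.1ᶜ P := rfl

theorem bML_apply (u : Fin n) (m : Rp n) :
    bML a u m = (∑ l : Fin n, (a u l : ℂ)) • (X u * m) - poissonBracket a (X u) m := by
  rw [poissonBracket_X_left]
  simp [bML, smul_eq_C_mul, mul_assoc]

theorem card_compl_of_card {q : ℕ} {j : ℤ} (h : j + q = n) {T : Finset (Fin n)}
    (hT : (T.card : ℤ) = j) : Tᶜ.card = q := by
  have h₁ := T.card_le_univ
  rw [Finset.card_compl, Fintype.card_fin]
  rw [Fintype.card_fin] at h₁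
  omega

/-- The comparison maps anticommute with the Poisson coboundary and boundary. -/
theorem bnd_dualityMap (ha : ∀ i j, a j i = - a i j) {q : ℕ} {j k : ℤ} (h : j + q = n)
    (hjk : j = k + 1) {P : W n q} (hP : P ∈ chiSub n q) :
    bnd a j k (dualityMap n q j P) = - dualityMap n (q + 1) k (dltL a q P) := by
  funext T
  have hT : (T.1ᶜ).card = q + 1 := card_compl_of_card (by push_cast; omega) T.2
  rw [Pi.neg_apply, dualityMap_apply, evalOn_dltL ha hP hT, Finset.smul_sum,
    ← Finset.sum_neg_distrib]
  simp only [bnd, LinearMap.pi_apply, LinearMap.sum_apply]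
  symm
  refine Finset.sum_subset_zero_on_sdiff (Finset.subset_univ _) ?_ ?_
  · intro u hu
    have hu' : u ∈ T.1 := by simpa using hu
    simp [hu']
  · intro u hu
    have hu' : u ∉ T.1 := by simpa using hu
    have hc : ((insert u T.1).card : ℤ) = j := by
      have h₁ := T.2
      rw [Finset.card_insert_of_notMem hu']
      push_cast
      omega
    have hcompl : (insert u T.1)ᶜ = T.1ᶜ.erase u := Finset.compl_insert
    have hcoef : (∑ l : Fin n, (a u l : ℂ)) + ∑ w ∈ T.1, (a w u : ℂ)
        = ∑ w ∈ T.1ᶜ.erase u, (a u w : ℂ) := by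
      have huu : a u u = 0 := by
        have := ha u u
        omega
      rw [← Finset.sum_add_sum_compl T.1, ← Finset.add_sum_erase _ _ hu, huu]
      simp only [fun w => ha u w, Int.cast_neg, Finset.sum_neg_distrib, Int.cast_zero]
      ring
    rw [if_neg hu', dif_pos hc]
    simp only [LinearMap.smul_apply, LinearMap.comp_apply, LinearMap.add_apply,
      LinearMap.proj_apply, dualityMap_apply, hcompl, map_smul, LinearMap.mulLeft_apply, bML_apply]
    generalize evalOn q (T.1ᶜ.erase u) P = m
    rw [← hcoef, smul_smul ((-1 : ℂ) ^ _), neg_one_pow_mul_dualSign_insert hu', ← smul_neg, ← smul_neg, smul_smul]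
    congr 1
    rw [add_smul]
    abel

theorem chiSub.eq_zero_of_evalOn {q : ℕ} {P : W n q} (hP : P ∈ chiSub n q)
    (h : ∀ S : Finset (Fin n), S.card = q → evalOn q S P = 0) : P = 0 := by
  have hX (s : Fin q → Fin n) : P (fun i => X (s i)) = 0 := by
    by_cases hs : Function.Injective s
    · have hmono : StrictMono (s ∘ Tuple.sort s) :=
        (Tuple.monotone_sort s).strictMono_of_injective (hs.comp (Equiv.injective _))
      have hcard : (Finset.univ.image s).card = q := by
        rw [Finset.card_image_of_injective _ hs, Finset.card_univ, Fintype.card_fin]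
      have he : s ∘ Tuple.sort s = (Finset.univ.image s).orderEmbOfFin hcard :=
        Finset.orderEmbOfFin_unique hcard (fun i => by simp) hmono
      have h₁ := h _ hcard
      rw [evalOn_apply hcard] at h₁
      have h₂ := hP.2.2.1 (fun i => X (s i)) (Tuple.sort s)
      have h₃ : (fun i => X (s i) : Fin q → Rp n) ∘ Tuple.sort s
          = fun i => X ((Finset.univ.image s).orderEmbOfFin hcard i) :=
        funext fun i => congrArg X (congrFun he i)
      rw [h₃, h₁] at h₂
      refine (smul_eq_zero.1 h₂.symm).resolve_left ?_
      rcases Int.units_eq_one_or (Equiv.Perm.sign (Tuple.sort s)) with h₄ | h₄ <;> simp [h₄]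
    · exact (chiSub.toAlternatingMap hP).map_eq_zero_of_not_injective _
        fun hinj => hs fun i j hij => hinj (congrArg X hij)
  have key (F : Finset (Fin q)) : ∀ f : Fin q → Rp n, (∀ i ∉ F, ∃ u, f i = X u) → P f = 0 := by
    induction F using Finset.induction_on with
    | empty =>
      intro f hf
      choose s hs using fun i => hf i (Finset.notMem_empty i)
      rw [funext hs]
      exact hX s
    | insert i F _ ih =>
      intro f hf
      let D : Derivation ℂ (Rp n) (Rp n) := Derivation.mk'
        { toFun := fun x => P (Function.update f i x)
          map_add' := hP.1 f i
          map_smul' := hP.2.1 f i } (hP.2.2.2 f i)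
      have hD : D = 0 := by
        refine MvPolynomial.derivation_ext fun u => ih _ fun l hl => ?_
        rcases eq_or_ne l i with rfl | hli
        · exact ⟨u, by simp⟩
        · obtain ⟨w, hw⟩ := hf l (by simp [hli, hl])
          exact ⟨w, by simp [hli, hw]⟩
      have h₁ : D (f i) = 0 := by rw [hD, Derivation.zero_apply]
      rw [← Function.update_eq_self i f]
      exact h₁
  funext f
  exact key Finset.univ f fun i hi => absurd (Finset.mem_univ i) hi

/-- The multiderivation `c ∂_{s_1} ∧ ⋯ ∧ ∂_{s_q}` with `S = {s_1 < ⋯ < s_q}`. -/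
def wedgeDerivation {q : ℕ} (S : Finset (Fin n)) (hS : S.card = q) (c : Rp n) : W n q :=
  fun f => c * Matrix.detRowAlternating fun i j => pderiv (S.orderEmbOfFin hS j) (f i)

theorem wedgeDerivation_mem_chiSub {q : ℕ} (S : Finset (Fin n)) (hS : S.card = q) (c : Rp n) :
    wedgeDerivation S hS c ∈ chiSub n q := by
  let d : Rp n → Fin q → Rp n := fun x j => pderiv (S.orderEmbOfFin hS j) x
  let M := Matrix.detRowAlternating (n := Fin q) (R := Rp n)
  have hd (f : Fin q → Rp n) : wedgeDerivation S hS c f = c * M (d ∘ f) := rfl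
  have hu (f : Fin q → Rp n) (i : Fin q) (x : Rp n) :
      wedgeDerivation S hS c (Function.update f i x)
        = c * M (Function.update (d ∘ f) i (d x)) := by
    rw [hd, Function.comp_update]
  refine ⟨fun v i x y => ?_, fun v i b x => ?_, fun v g => ?_, fun v i x y => ?_⟩
  · have h : d (x + y) = d x + d y := by
      funext j
      simp [d]
    rw [hu, hu, hu, h, M.map_update_add, mul_add]
  · have h : d (b • x) = (C b : Rp n) • d x := by
      funext j
      simp [d, smul_eq_C_mul]
    rw [hu, hu, h, M.map_update_smul, smul_eq_C_mul, smul_eq_mul]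
    ring
  · rw [hd, hd, ← Function.comp_assoc, M.map_perm, Units.smul_def, ← Int.cast_smul_eq_zsmul ℂ,
      mul_smul_comm]
  · have h : d (x * y) = x • d y + y • d x := by
      funext j
      simp [d]
    rw [hu, hu, hu, h, M.map_update_add, M.map_update_smul, M.map_update_smul, smul_eq_mul,
      smul_eq_mul]
    ring

theorem evalOn_wedgeDerivation_self {q : ℕ} (S : Finset (Fin n)) (hS : S.card = q) (c : Rp n) :
    evalOn q S (wedgeDerivation S hS c) = c := by
  rw [evalOn_apply hS, wedgeDerivation]
  have h : (fun i j => pderiv (S.orderEmbOfFin hS j) (X (S.orderEmbOfFin hS i) : Rp n))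
      = (1 : Matrix (Fin q) (Fin q) (Rp n)) := by
    funext i j
    simp [pderiv_X, Pi.single_apply, Matrix.one_apply]
  rw [h, ← Matrix.det, Matrix.det_one, mul_one]

theorem evalOn_wedgeDerivation_of_ne {q : ℕ} {S T : Finset (Fin n)} (hS : S.card = q)
    (hT : T.card = q) (hne : T ≠ S) (c : Rp n) : evalOn q T (wedgeDerivation S hS c) = 0 := by
  rw [evalOn_apply hT, wedgeDerivation]
  obtain ⟨u, hu, hu'⟩ : ∃ u ∈ T, u ∉ S := by
    by_contra! h
    exact hne (Finset.eq_of_subset_of_card_le h (by omega))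
  obtain ⟨i, rfl⟩ : u ∈ Set.range (T.orderEmbOfFin hT) := by
    rwa [Finset.range_orderEmbOfFin]
  rw [AlternatingMap.map_coord_zero _ i, mul_zero]
  funext j
  refine pderiv_X_of_ne fun h => hu' ?_
  rw [h]
  exact S.orderEmbOfFin_mem hS j

theorem dualityMap_injOn {q : ℕ} {j : ℤ} (h : j + q = n) {P : W n q} (hP : P ∈ chiSub n q)
    (h₀ : dualityMap n q j P = 0) : P = 0 := by
  refine chiSub.eq_zero_of_evalOn hP fun S hS => ?_
  have hc : (Sᶜ.card : ℤ) = j := by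
    have := S.card_add_card_compl
    rw [Fintype.card_fin] at this
    omega
  have h₁ := congrFun h₀ ⟨Sᶜ, hc⟩
  rw [dualityMap_apply, compl_compl] at h₁
  refine (smul_eq_zero.1 h₁).resolve_left fun h₂ => ?_
  simpa [h₂] using dualSign_mul_self Sᶜ

theorem exists_dualityMap_eq {q : ℕ} {j : ℤ} (h : j + q = n) (m : Ch n j) :
    ∃ P ∈ chiSub n q, dualityMap n q j P = m := by
  refine ⟨∑ T : cIdx n j, wedgeDerivation (T.1)ᶜ (card_compl_of_card h T.2) (dualSign T.1 • m T),
    Submodule.sum_mem _ fun T _ => wedgeDerivation_mem_chiSub _ _ _, ?_⟩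
  funext T
  rw [dualityMap_apply, map_sum, Finset.sum_eq_single T, evalOn_wedgeDerivation_self, smul_smul,
    dualSign_mul_self, one_smul]
  · intro U _ hU
    exact evalOn_wedgeDerivation_of_ne _ (card_compl_of_card h T.2)
      (fun hTU => hU (Subtype.ext (compl_injective hTU).symm)) _
  · simp

/-- The comparison map detects cocycles. -/
theorem dualityMap_mem_Zc_iff (ha : ∀ i j, a j i = - a i j) {q : ℕ} {j : ℤ} (h : j + q = n)
    {P : W n q} (hP : P ∈ chiSub n q) : dualityMap n q j P ∈ Zc a j ↔ P ∈ Zcoh n a q := by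
  rw [Zc, LinearMap.mem_ker, bnd_dualityMap ha h (by ring) hP, neg_eq_zero, Zcoh,
    Submodule.mem_inf, LinearMap.mem_ker]
  constructor
  · exact fun h₀ => ⟨hP, dualityMap_injOn (by push_cast; omega) (dltL_mem_chiSub ha hP) h₀⟩
  · rintro ⟨_, h₀⟩
    rw [h₀, map_zero]

theorem dualityMap_mem_range_bnd_iff (ha : ∀ i j, a j i = - a i j) {q : ℕ} {j : ℤ} (h : j + q = n)
    {P : W n q} (hP : P ∈ chiSub n q) :
    dualityMap n q j P ∈ LinearMap.range (bnd a (j + 1) j) ↔ P ∈ Bcoh n a q := by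
  cases q with
  | zero =>
    have hempty : IsEmpty (cIdx n (j + 1)) := ⟨fun T => by
      have h₁ := T.1.card_le_univ
      rw [Fintype.card_fin] at h₁
      have h₂ := T.2
      simp only [Nat.cast_zero] at h
      omega⟩
    simp only [Bcoh, Submodule.mem_bot, LinearMap.mem_range]
    constructor
    · rintro ⟨m, hm⟩
      rw [Subsingleton.elim m 0, map_zero] at hm
      exact dualityMap_injOn h hP hm.symm
    · rintro rfl
      exact ⟨0, by rw [map_zero, map_zero]⟩
  | succ q =>
    have h' : j + 1 + q = n := by push_cast at h; omega
    simp only [Bcoh, Submodule.mem_map, LinearMap.mem_range]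
    constructor
    · rintro ⟨m, hm⟩
      obtain ⟨Q, hQ, rfl⟩ := exists_dualityMap_eq h' m
      rw [bnd_dualityMap ha h' rfl hQ, ← map_neg] at hm
      refine ⟨-Q, Submodule.neg_mem _ hQ, ?_⟩
      rw [map_neg, ← sub_eq_zero]
      refine dualityMap_injOn h (Submodule.sub_mem _
        (Submodule.neg_mem _ (dltL_mem_chiSub ha hQ)) hP) ?_
      rw [map_sub, hm, sub_self]
    · rintro ⟨Q, hQ, rfl⟩
      exact ⟨-dualityMap n q (j + 1) Q, by rw [map_neg, bnd_dualityMap ha h' rfl hQ, neg_neg]⟩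

/-- The comparison map as an isomorphism from cocycles to cycles. -/
def cocycleEquivCycle (ha : ∀ i j, a j i = - a i j) {q : ℕ} {j : ℤ} (h : j + q = n) :
    Zcoh n a q ≃ₗ[ℂ] Zc a j :=
  LinearEquiv.ofBijective
    ((dualityMap n q j).restrict (p := Zcoh n a q) (q := Zc a j)
      fun _ hP => (dualityMap_mem_Zc_iff ha h hP.1).2 hP) <| by
    constructor
    · rw [← LinearMap.ker_eq_bot, LinearMap.ker_eq_bot']
      intro P hP
      exact Subtype.ext (dualityMap_injOn h P.2.1 (congrArg Subtype.val hP))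
    · intro m
      obtain ⟨P, hP, hPm⟩ := exists_dualityMap_eq h m.1
      exact ⟨⟨P, (dualityMap_mem_Zc_iff ha h hP).1 (hPm ▸ m.2)⟩, Subtype.ext hPm⟩

end Duality

/-- Main theorem: twisted Poincaré duality: for every `0 ≤ k ≤ n` there
is an isomorphism of ℂ-vector spaces `HP_k(R, M) ≅ HP^{n−k}(R)` between the `k`-th
Poisson homology of `R` with values in the Poisson module `M` and the `(n−k)`-th
Poisson cohomology of `R`. -/
theorem twisted_poincare_duality
    (n : ℕ) (hn : 1 ≤ n) (a : Fin n → Fin n → ℤ)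
    (ha : ∀ i j, a j i = - a i j) (k : ℕ) (hk : k ≤ n) :
    Nonempty ((HPhom n a (k : ℤ)) ≃ₗ[ℂ] (HPcoh n a (n - k))) := by
  have h : (k : ℤ) + ((n - k : ℕ) : ℤ) = n := by omega
  refine ⟨(Submodule.Quotient.equiv _ _ (cocycleEquivCycle ha h) ?_).symm⟩
  ext m
  obtain ⟨P, rfl⟩ := (cocycleEquivCycle ha h).surjective m
  rw [Submodule.mem_map_equiv, LinearEquiv.symm_apply_apply]
  exact (dualityMap_mem_range_bnd_iff ha h P.2.1).symm
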